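/- arXiv:2202.04156 — 4 statements merged into one kernel-verified Lean document; each statement's English description precedes it below -/
import Mathlib

section
/- For every continuous compactly supported function f : ℝ² → ℝ, the limit lim_{L→∞} (1/L²) · Σ_{(a,b) ∈ ℤ², gcd(a,b)=1} f(a/L, b/L) exists and equals (6/π²) · ∫_{ℝ²} f dλ, where λ is the Lebesgue measure on ℝ². (Equivalently, the rescaled counting measures ν_L^prim := L^{-2} Σ_{v primitive} δ_{v/L} converge in the weak-⋆ topology to (6/π²)·λ as L → ∞.) -/
open Filter MeasureTheory

open scoped ArithmeticFunction.Moebius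

theorem tsum_moebius_div_sq : ∑' d : ℕ, (μ d : ℝ) / (d : ℝ) ^ 2 = 6 / Real.pi ^ 2 := by
  have hs : 1 < (2 : ℂ).re := by norm_num
  have h := ArithmeticFunction.LSeries_zeta_mul_Lseries_moebius hs
  rw [ArithmeticFunction.LSeries_zeta_eq_riemannZeta hs, riemannZeta_two] at h
  have hL : LSeries (fun n ↦ ((μ n : ℤ) : ℂ)) 2 =
      ((∑' d : ℕ, (μ d : ℝ) / (d : ℝ) ^ 2 : ℝ) : ℂ) := by
    rw [Complex.ofReal_tsum, LSeries]
    refine tsum_congr fun n ↦ ?_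
    rw [LSeries.term_of_ne_zero' two_ne_zero]
    push_cast
    norm_cast
  rw [hL] at h
  have h' : Real.pi ^ 2 / 6 * ∑' d : ℕ, (μ d : ℝ) / (d : ℝ) ^ 2 = 1 := by exact_mod_cast h
  have := Real.pi_pos
  field_simp at h' ⊢
  linarith

theorem sum_divisors_moebius (n : ℕ) :
    ∑ d ∈ n.divisors, μ d = if n = 1 then 1 else 0 := by
  rw [← ArithmeticFunction.coe_mul_zeta_apply, ArithmeticFunction.moebius_mul_coe_zeta,
    ArithmeticFunction.one_apply]

/-- Möbius inversion for sums over primitive vectors. -/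
theorem tsum_primitive_eq_tsum_moebius (h : ℤ × ℤ → ℝ) (hfin : h.support.Finite)
    (h0 : h 0 = 0) :
    ∑' v : {v : ℤ × ℤ // Int.gcd v.1 v.2 = 1}, h v =
      ∑' d : ℕ, (μ d : ℝ) * ∑' w : ℤ × ℤ, h ((d : ℤ) • w) := by
  set g : ℤ × ℤ → ℕ → ℝ := fun v d ↦ if d ∣ Int.gcd v.1 v.2 then (μ d : ℝ) * h v else 0 with hg
  have hgcd : ∀ v, h v ≠ 0 → Int.gcd v.1 v.2 ≠ 0 := by
    rintro v hv h'
    rw [Int.gcd_eq_zero_iff] at h'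
    exact hv (by rw [show v = 0 from Prod.ext h'.1 h'.2, h0])
  have hsum : Summable (Function.uncurry g) := by
    refine summable_of_hasFiniteSupport (Set.Finite.subset
      (hfin.biUnion fun v _ ↦ ((Int.gcd v.1 v.2).divisors.finite_toSet.image (Prod.mk v))) ?_)
    rintro ⟨v, d⟩ hvd
    simp only [Function.mem_support, Function.uncurry, hg, ne_eq, ite_eq_right_iff,
      mul_eq_zero, not_forall, not_or] at hvd
    obtain ⟨hd, -, hv⟩ := hvd
    simp only [Set.mem_iUnion, Set.mem_image]
    exact ⟨v, hv, d, Nat.mem_divisors.2 ⟨hd, hgcd v hv⟩, rfl⟩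
  have hrow : ∀ v, ∑' d, g v d = {v : ℤ × ℤ | Int.gcd v.1 v.2 = 1}.indicator h v := by
    intro v
    by_cases hv : h v = 0
    · simp [hg, hv, Set.indicator]
    · rw [tsum_eq_sum (s := (Int.gcd v.1 v.2).divisors)
        fun d hd ↦ if_neg fun hd' ↦ hd (Nat.mem_divisors.2 ⟨hd', hgcd v hv⟩),
        Finset.sum_congr rfl fun d hd ↦ if_pos (Nat.dvd_of_mem_divisors hd),
        ← Finset.sum_mul, ← Int.cast_sum, sum_divisors_moebius]
      by_cases h1 : Int.gcd v.1 v.2 = 1 <;> simp [h1]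
  have hcol : ∀ d : ℕ, ∑' v, g v d = (μ d : ℝ) * ∑' w : ℤ × ℤ, h ((d : ℤ) • w) := by
    intro d
    rcases eq_or_ne d 0 with rfl | hd
    · simp [hg]
    have hd' : (d : ℤ) ≠ 0 := by exact_mod_cast hd
    have hinj : Function.Injective fun w : ℤ × ℤ ↦ (d : ℤ) • w := smul_right_injective _ hd'
    rw [← hinj.tsum_eq, ← tsum_mul_left]
    · refine tsum_congr fun w ↦ if_pos ?_
      refine Int.dvd_gcd ?_ ?_ <;> simp
    · intro v hv
      simp only [Function.mem_support, hg, ne_eq, ite_eq_right_iff, not_forall] at hv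
      have hdv := Int.natCast_dvd_natCast.2 hv.1
      obtain ⟨a, ha⟩ := hdv.trans (Int.gcd_dvd_left _ _)
      obtain ⟨b, hb⟩ := hdv.trans (Int.gcd_dvd_right _ _)
      exact ⟨(a, b), Prod.ext ha.symm hb.symm⟩
  calc _ = ∑' v, ∑' d, g v d := by
        rw [tsum_congr hrow]
        exact tsum_subtype {v : ℤ × ℤ | Int.gcd v.1 v.2 = 1} h
    _ = ∑' d, ∑' v, g v d := hsum.tsum_comm.symm
    _ = _ := tsum_congr hcol

theorem map_floor_prod_volume :
    Measure.map (fun x : ℝ × ℝ ↦ ((⌊x.1⌋, ⌊x.2⌋) : ℤ × ℤ)) volume = Measure.count := by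
  refine Measure.ext_of_singleton fun v ↦ ?_
  rw [Measure.map_apply (by fun_prop) (measurableSet_singleton v), Measure.count_singleton]
  have : (fun x : ℝ × ℝ ↦ ((⌊x.1⌋, ⌊x.2⌋) : ℤ × ℤ)) ⁻¹' {v} =
      Set.Ico (v.1 : ℝ) (v.1 + 1) ×ˢ Set.Ico (v.2 : ℝ) (v.2 + 1) := by
    ext x
    simp [Prod.ext_iff, Int.floor_eq_iff]
  rw [this, Measure.volume_eq_prod, Measure.prod_prod]
  simp

theorem integral_comp_floor_prod (g : ℤ × ℤ → ℝ) (hg : g.support.Finite) :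
    ∫ x : ℝ × ℝ, g (⌊x.1⌋, ⌊x.2⌋) = ∑' v, g v := by
  have hm : Measurable fun x : ℝ × ℝ ↦ ((⌊x.1⌋, ⌊x.2⌋) : ℤ × ℤ) := by fun_prop
  have hint : Integrable g Measure.count :=
    integrable_count_iff.2 (summable_of_hasFiniteSupport hg).norm
  rw [← integral_map (f := g) hm.aemeasurable (Measurable.of_discrete.aestronglyMeasurable),
    map_floor_prod_volume, integral_countable hint]
  simp [measureReal_def]

theorem finite_support_lattice {f : ℝ × ℝ → ℝ} (hsupp : HasCompactSupport f) {L : ℝ} (hL : 0 < L) :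
    (Function.support fun v : ℤ × ℤ ↦ f (v.1 / L, v.2 / L)).Finite := by
  obtain ⟨R, hR⟩ := hsupp.isCompact.isBounded.subset_closedBall 0
  refine Set.Finite.subset ((Set.finite_Icc ⌈-(R * L)⌉ ⌊R * L⌋).prod
    (Set.finite_Icc ⌈-(R * L)⌉ ⌊R * L⌋)) fun v hv ↦ ?_
  have := hR (subset_tsupport f hv)
  rw [mem_closedBall_zero_iff, Prod.norm_def, max_le_iff] at this
  simp only [Real.norm_eq_abs, abs_div, abs_of_pos hL, div_le_iff₀ hL, abs_le] at this
  simpa only [Set.mem_prod, Set.mem_Icc, Int.ceil_le, Int.le_floor] using this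

theorem riemann_sum_eq_integral {f : ℝ × ℝ → ℝ} (hsupp : HasCompactSupport f) {L : ℝ}
    (hL : 0 < L) :
    1 / L ^ 2 * ∑' v : ℤ × ℤ, f (v.1 / L, v.2 / L) =
      ∫ x : ℝ × ℝ, f (⌊L * x.1⌋ / L, ⌊L * x.2⌋ / L) := by
  rw [← integral_comp_floor_prod _ (finite_support_lattice hsupp hL)]
  have := Measure.integral_comp_smul (volume : Measure (ℝ × ℝ))
    (fun x : ℝ × ℝ ↦ f (⌊x.1⌋ / L, ⌊x.2⌋ / L)) L
  simp only [Prod.smul_fst, Prod.smul_snd, smul_eq_mul, Module.finrank_prod,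
    Module.finrank_self] at this
  rw [this, abs_of_pos (by positivity)]
  norm_num

theorem abs_floor_mul_div_sub_le {L : ℝ} (hL : 0 < L) (x : ℝ) : |⌊L * x⌋ / L - x| ≤ 1 / L := by
  rw [show ⌊L * x⌋ / L - x = (⌊L * x⌋ - L * x) / L by field_simp, abs_div, abs_of_pos hL]
  gcongr
  rw [abs_le]
  constructor <;> linarith [Int.floor_le (L * x), Int.lt_floor_add_one (L * x)]

theorem norm_floor_mul_div_sub_le {L : ℝ} (hL : 0 < L) (x : ℝ × ℝ) :
    ‖((⌊L * x.1⌋ / L, ⌊L * x.2⌋ / L) : ℝ × ℝ) - x‖ ≤ 1 / L :=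
  max_le (abs_floor_mul_div_sub_le hL x.1) (abs_floor_mul_div_sub_le hL x.2)

theorem norm_comp_floor_le {f : ℝ × ℝ → ℝ} {R M : ℝ} (hR : 0 < R)
    (hsupp : tsupport f ⊆ Metric.closedBall 0 R) (hM : ∀ x, ‖f x‖ ≤ M) {L : ℝ} (hL : 1 / R ≤ L)
    (x : ℝ × ℝ) :
    ‖f (⌊L * x.1⌋ / L, ⌊L * x.2⌋ / L)‖ ≤
      (Metric.closedBall (0 : ℝ × ℝ) (2 * R)).indicator (fun _ ↦ M) x := by
  have hL0 : 0 < L := (by positivity : 0 < 1 / R).trans_le hL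
  by_cases hx : x ∈ Metric.closedBall (0 : ℝ × ℝ) (2 * R)
  · simpa [hx] using hM _
  · rw [Set.indicator_of_notMem hx, norm_le_zero_iff]
    refine image_eq_zero_of_notMem_tsupport fun hmem ↦ ?_
    have h1 := hsupp hmem
    rw [mem_closedBall_zero_iff] at h1 hx
    have h2 := norm_floor_mul_div_sub_le hL0 x
    have h3 : 1 / L ≤ R := (one_div_le hR hL0).1 hL
    have h4 := norm_sub_le ((⌊L * x.1⌋ / L, ⌊L * x.2⌋ / L) : ℝ × ℝ)
      (((⌊L * x.1⌋ / L, ⌊L * x.2⌋ / L) : ℝ × ℝ) - x)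
    rw [sub_sub_cancel] at h4
    linarith

theorem integrable_indicator_closedBall_const (M R : ℝ) :
    Integrable ((Metric.closedBall (0 : ℝ × ℝ) R).indicator fun _ ↦ M) :=
  (integrable_indicator_iff Metric.isClosed_closedBall.measurableSet).2
    (integrableOn_const (isCompact_closedBall _ _).measure_lt_top.ne)

theorem exists_support_radius_and_bound {f : ℝ × ℝ → ℝ} (hf : Continuous f)
    (hsupp : HasCompactSupport f) :
    ∃ R M : ℝ, 0 < R ∧ tsupport f ⊆ Metric.closedBall 0 R ∧ ∀ x, ‖f x‖ ≤ M := by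
  obtain ⟨R, hR0, hR⟩ := hsupp.isCompact.isBounded.subset_closedBall_lt 0 0
  obtain ⟨M, hM⟩ := hsupp.exists_bound_of_continuous hf
  exact ⟨R, M, hR0, hR, hM⟩

theorem tendsto_riemann_sum {f : ℝ × ℝ → ℝ} (hf : Continuous f) (hsupp : HasCompactSupport f) :
    Tendsto (fun L : ℝ ↦ 1 / L ^ 2 * ∑' v : ℤ × ℤ, f (v.1 / L, v.2 / L)) atTop
      (nhds (∫ x, f x)) := by
  obtain ⟨R, M, hR0, hR, hM⟩ := exists_support_radius_and_bound hf hsupp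
  refine Tendsto.congr' (f₁ := fun L : ℝ ↦ ∫ x : ℝ × ℝ, f (⌊L * x.1⌋ / L, ⌊L * x.2⌋ / L)) ?_ ?_
  · filter_upwards [eventually_gt_atTop 0] with L hL
    exact (riemann_sum_eq_integral hsupp hL).symm
  refine tendsto_integral_filter_of_dominated_convergence
    ((Metric.closedBall (0 : ℝ × ℝ) (2 * R)).indicator fun _ ↦ M) ?_ ?_
    (integrable_indicator_closedBall_const _ _) ?_
  · refine Eventually.of_forall fun L ↦ (Measurable.aestronglyMeasurable ?_)
    exact hf.measurable.comp (by fun_prop)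
  · filter_upwards [eventually_ge_atTop (1 / R)] with L hL
    exact Eventually.of_forall (norm_comp_floor_le hR0 hR hM hL)
  · refine Eventually.of_forall fun x ↦ (hf.tendsto x).comp ?_
    rw [tendsto_iff_norm_sub_tendsto_zero]
    refine squeeze_zero' (Eventually.of_forall fun _ ↦ norm_nonneg _) ?_
      (tendsto_const_nhds.div_atTop tendsto_id : Tendsto (fun L : ℝ ↦ 1 / L) atTop (nhds 0))
    filter_upwards [eventually_gt_atTop 0] with L hL
    exact norm_floor_mul_div_sub_le hL x

/-- The rescaled sample of `f` on the lattice `L⁻¹ ℤ²`, with the origin removed. -/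
noncomputable def puncturedSample (f : ℝ × ℝ → ℝ) (L : ℝ) (v : ℤ × ℤ) : ℝ :=
  if v = 0 then 0 else f (v.1 / L, v.2 / L)

theorem finite_support_puncturedSample {f : ℝ × ℝ → ℝ} (hsupp : HasCompactSupport f) {L : ℝ}
    (hL : 0 < L) : (puncturedSample f L).support.Finite :=
  (finite_support_lattice hsupp hL).subset fun v hv ↦ by
    simp only [Function.mem_support, puncturedSample, ne_eq, ite_eq_left_iff, not_forall] at hv
    exact hv.2

theorem puncturedSample_natCast_smul (f : ℝ × ℝ → ℝ) (L : ℝ) {d : ℕ} (hd : d ≠ 0) (w : ℤ × ℤ) :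
    puncturedSample f L ((d : ℤ) • w) = puncturedSample f (L / d) w := by
  have hd' : (d : ℤ) ≠ 0 := by exact_mod_cast hd
  have h (a : ℤ) : ((d : ℝ) * a) / L = a / (L / d) := by rw [div_div_eq_mul_div, mul_comm]
  simp only [puncturedSample, smul_eq_zero, hd', false_or]
  simp [h]

theorem tsum_puncturedSample {f : ℝ × ℝ → ℝ} (hsupp : HasCompactSupport f) {L : ℝ} (hL : 0 < L) :
    ∑' v, puncturedSample f L v = ∑' v : ℤ × ℤ, f (v.1 / L, v.2 / L) - f 0 := by
  have hs : Summable fun v : ℤ × ℤ ↦ f (v.1 / L, v.2 / L) :=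
    summable_of_hasFiniteSupport (finite_support_lattice hsupp hL)
  have := hs.tsum_eq_add_tsum_ite 0
  rw [this]
  simp [puncturedSample, ← Prod.zero_eq_mk]

theorem tendsto_punctured_riemann_sum {f : ℝ × ℝ → ℝ} (hf : Continuous f)
    (hsupp : HasCompactSupport f) :
    Tendsto (fun L : ℝ ↦ 1 / L ^ 2 * ∑' v, puncturedSample f L v) atTop (nhds (∫ x, f x)) := by
  have h0 : Tendsto (fun L : ℝ ↦ 1 / L ^ 2 * f 0) atTop (nhds 0) := by
    simpa using (tendsto_const_nhds.div_atTop (tendsto_pow_atTop two_ne_zero) :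
      Tendsto (fun L : ℝ ↦ 1 / L ^ 2) atTop (nhds 0)).mul_const (f 0)
  have h := (tendsto_riemann_sum hf hsupp).sub h0
  rw [sub_zero] at h
  refine h.congr' ?_
  filter_upwards [eventually_gt_atTop 0] with L hL
  rw [tsum_puncturedSample hsupp hL, mul_sub]

theorem puncturedSample_eq_zero {f : ℝ × ℝ → ℝ} {R L : ℝ} (hR : 0 < R)
    (hsupp : tsupport f ⊆ Metric.closedBall 0 R) (hL : 0 < L) (hLR : L < 1 / R) (v : ℤ × ℤ) :
    puncturedSample f L v = 0 := by
  by_contra h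
  simp only [puncturedSample, ite_eq_left_iff, not_forall] at h
  obtain ⟨hv, hfv⟩ := h
  have h1 := hsupp (subset_tsupport f hfv)
  rw [mem_closedBall_zero_iff, Prod.norm_def, max_le_iff] at h1
  simp only [Real.norm_eq_abs, abs_div, abs_of_pos hL, div_le_iff₀ hL] at h1
  have h2 : R * L < 1 := by rwa [lt_div_iff₀ hR, mul_comm] at hLR
  have hz (a : ℤ) (ha : |(a : ℝ)| ≤ R * L) : a = 0 :=
    Int.abs_lt_one_iff.1 (by exact_mod_cast ha.trans_lt h2)
  exact hv (Prod.ext (hz _ h1.1) (hz _ h1.2))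

theorem exists_bound_punctured_riemann_sum {f : ℝ × ℝ → ℝ} (hf : Continuous f)
    (hsupp : HasCompactSupport f) :
    ∃ C, ∀ L : ℝ, 0 < L → |1 / L ^ 2 * ∑' v, puncturedSample f L v| ≤ C := by
  obtain ⟨R, M, hR0, hR, hM⟩ := exists_support_radius_and_bound hf hsupp
  have hM0 : 0 ≤ M := (norm_nonneg _).trans (hM 0)
  set I := ∫ x, (Metric.closedBall (0 : ℝ × ℝ) (2 * R)).indicator (fun _ ↦ M) x
  have hI0 : 0 ≤ I := integral_nonneg fun x ↦ Set.indicator_nonneg (fun _ _ ↦ hM0) x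
  refine ⟨I + R ^ 2 * M, fun L hL ↦ ?_⟩
  rcases lt_or_ge L (1 / R) with hLR | hLR
  · simp only [puncturedSample_eq_zero hR0 hR hL hLR, tsum_zero, mul_zero, abs_zero]
    positivity
  · rw [tsum_puncturedSample hsupp hL, mul_sub, riemann_sum_eq_integral hsupp hL]
    refine (abs_sub _ _).trans (add_le_add ?_ ?_)
    · exact norm_integral_le_of_norm_le (integrable_indicator_closedBall_const _ _)
        (Eventually.of_forall (norm_comp_floor_le hR0 hR hM hLR))
    · rw [abs_mul, abs_of_pos (by positivity), ← one_div_pow]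
      have := (one_div_le hR0 hL).1 hLR
      gcongr
      exact hM 0

theorem primitive_sum_eq_tsum_moebius {f : ℝ × ℝ → ℝ} (hsupp : HasCompactSupport f) {L : ℝ}
    (hL : 0 < L) :
    (1 / L ^ 2) * ∑' v : {v : ℤ × ℤ // Int.gcd v.1 v.2 = 1},
        f (((v : ℤ × ℤ).1 : ℝ) / L, ((v : ℤ × ℤ).2 : ℝ) / L) =
      ∑' d : ℕ, (μ d : ℝ) / (d : ℝ) ^ 2 *
        (1 / (L / d) ^ 2 * ∑' w, puncturedSample f (L / d) w) := by
  have h := tsum_primitive_eq_tsum_moebius _ (finite_support_puncturedSample hsupp hL)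
    (if_pos rfl)
  have h' : ∑' v : {v : ℤ × ℤ // Int.gcd v.1 v.2 = 1},
      f (((v : ℤ × ℤ).1 : ℝ) / L, ((v : ℤ × ℤ).2 : ℝ) / L) =
      ∑' v : {v : ℤ × ℤ // Int.gcd v.1 v.2 = 1}, puncturedSample f L v := by
    refine tsum_congr fun v ↦ (if_neg ?_).symm
    intro hv
    simpa [hv] using v.2
  rw [h', h, ← tsum_mul_left]
  refine tsum_congr fun d ↦ ?_
  rcases eq_or_ne d 0 with rfl | hd
  · simp
  simp only [puncturedSample_natCast_smul f L hd]
  field_simp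

/-- **Equidistribution of primitive integer points.** The rescaled primitive counting
measures `ν_L^prim := L⁻² Σ_{v primitive} δ_{v/L}` converge weak-⋆ to `(6/π²)` times
the Lebesgue measure on `ℝ²`: for every continuous compactly supported `f : ℝ² → ℝ`,
`(1/L²) Σ_{gcd(a,b)=1} f(a/L, b/L) → (6/π²) ∫ f dλ` as `L → ∞`. -/
theorem primitive_counting_measures_equidistribute
    (f : ℝ × ℝ → ℝ) (hf : Continuous f) (hsupp : HasCompactSupport f) :
    Tendsto (fun L : ℝ =>
        (1 / L ^ 2) * ∑' v : {v : ℤ × ℤ // Int.gcd v.1 v.2 = 1},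
          f (((v : ℤ × ℤ).1 : ℝ) / L, ((v : ℤ × ℤ).2 : ℝ) / L))
      atTop (nhds ((6 / Real.pi ^ 2) * ∫ x, f x)) := by
  obtain ⟨C, hC⟩ := exists_bound_punctured_riemann_sum hf hsupp
  rw [← tsum_moebius_div_sq, ← tsum_mul_right]
  refine Tendsto.congr' (f₁ := fun L : ℝ ↦ ∑' d : ℕ, (μ d : ℝ) / (d : ℝ) ^ 2 *
    (1 / (L / d) ^ 2 * ∑' w, puncturedSample f (L / d) w)) ?_ ?_
  · filter_upwards [eventually_gt_atTop 0] with L hL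
    exact (primitive_sum_eq_tsum_moebius hsupp hL).symm
  refine tendsto_tsum_of_dominated_convergence (bound := fun d : ℕ ↦ 1 / (d : ℝ) ^ 2 * C)
    ((Real.summable_one_div_nat_pow.2 one_lt_two).mul_right C) (fun d ↦ ?_) ?_
  · rcases eq_or_ne d 0 with rfl | hd
    · simp
    · exact ((tendsto_punctured_riemann_sum hf hsupp).comp
        (tendsto_id.atTop_div_const (by positivity))).const_mul _
  · filter_upwards [eventually_gt_atTop 0] with L hL d
    rcases eq_or_ne d 0 with rfl | hd
    · simp
    rw [norm_mul, norm_div, Real.norm_eq_abs, Real.norm_eq_abs, Real.norm_eq_abs,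
      abs_of_nonneg (by positivity : (0 : ℝ) ≤ (d : ℝ) ^ 2)]
    have hμ : |(μ d : ℝ)| ≤ 1 := by exact_mod_cast ArithmeticFunction.abs_moebius_le_one
    gcongr
    exact hC _ (by positivity)
end

section
/- Let (L_k)_{k∈ℕ} be a sequence of positive reals tending to ∞, and let μ' be a locally finite Borel measure on ℝ² such that for every continuous compactly supported f : ℝ² → ℝ one has (1/L_k²) · Σ_{(a,b) ∈ ℤ², gcd(a,b)=1} f(a/L_k, b/L_k) → ∫_{ℝ²} f dμ'. Then μ' is invariant under the linear action of SL(2,ℤ): for every matrix M ∈ SL(2,ℤ) and every Borel set A ⊆ ℝ², μ'({M·v : v ∈ A}) = μ'(A). -/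
open Filter MeasureTheory

/-- The linear action of an integer matrix of determinant one on `ℝ × ℝ`. -/
def planeAction (M : Matrix.SpecialLinearGroup (Fin 2) ℤ) (v : ℝ × ℝ) : ℝ × ℝ :=
  (((M : Matrix (Fin 2) (Fin 2) ℤ) 0 0 : ℝ) * v.1
      + ((M : Matrix (Fin 2) (Fin 2) ℤ) 0 1 : ℝ) * v.2,
    ((M : Matrix (Fin 2) (Fin 2) ℤ) 1 0 : ℝ) * v.1
      + ((M : Matrix (Fin 2) (Fin 2) ℤ) 1 1 : ℝ) * v.2)

theorem planeAction_mul (M N : Matrix.SpecialLinearGroup (Fin 2) ℤ) (v : ℝ × ℝ) :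
    planeAction (M * N) v = planeAction M (planeAction N v) := by
  ext <;> simp [planeAction, Matrix.mul_apply, Fin.sum_univ_two] <;> ring

theorem planeAction_one (v : ℝ × ℝ) : planeAction 1 v = v := by
  ext <;> simp [planeAction]

theorem continuous_planeAction (M : Matrix.SpecialLinearGroup (Fin 2) ℤ) :
    Continuous (planeAction M) := by
  unfold planeAction
  fun_prop

/-- The linear action of an integer matrix of determinant one, as a homeomorphism of the plane. -/
def planeHomeomorph (M : Matrix.SpecialLinearGroup (Fin 2) ℤ) : ℝ × ℝ ≃ₜ ℝ × ℝ where
  toFun := planeAction M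
  invFun := planeAction M⁻¹
  left_inv v := by rw [← planeAction_mul, inv_mul_cancel, planeAction_one]
  right_inv v := by rw [← planeAction_mul, mul_inv_cancel, planeAction_one]
  continuous_toFun := continuous_planeAction M
  continuous_invFun := continuous_planeAction M⁻¹

/-- Integer vectors with coprime coordinates. -/
abbrev PrimitiveVector : Type := {v : ℤ × ℤ // Int.gcd v.1 v.2 = 1}

/-- The inclusion of the primitive vectors into the plane, rescaled by `1 / L`. -/
noncomputable def rescaledPoint (L : ℝ) (v : PrimitiveVector) : ℝ × ℝ :=
  (((v : ℤ × ℤ).1 : ℝ) / L, ((v : ℤ × ℤ).2 : ℝ) / L)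

/-- The linear action of `SL(2,ℤ)` preserves primitive vectors. -/
def primitiveAction (M : Matrix.SpecialLinearGroup (Fin 2) ℤ) (v : PrimitiveVector) :
    PrimitiveVector :=
  ⟨((M : Matrix (Fin 2) (Fin 2) ℤ) 0 0 * v.1.1 + (M : Matrix (Fin 2) (Fin 2) ℤ) 0 1 * v.1.2,
    (M : Matrix (Fin 2) (Fin 2) ℤ) 1 0 * v.1.1 + (M : Matrix (Fin 2) (Fin 2) ℤ) 1 1 * v.1.2), by
    obtain ⟨⟨a, b⟩, hv⟩ := v
    obtain ⟨x, y, hxy⟩ := Int.isCoprime_iff_gcd_eq_one.mpr hv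
    have hdet := M.det_coe
    rw [Matrix.det_fin_two] at hdet
    refine Int.isCoprime_iff_gcd_eq_one.mp
      ⟨x * (M : Matrix (Fin 2) (Fin 2) ℤ) 1 1 - y * (M : Matrix (Fin 2) (Fin 2) ℤ) 1 0,
        y * (M : Matrix (Fin 2) (Fin 2) ℤ) 0 0 - x * (M : Matrix (Fin 2) (Fin 2) ℤ) 0 1, ?_⟩
    simp only at hxy ⊢
    linear_combination hxy + (x * a + y * b) * hdet⟩

theorem primitiveAction_mul (M N : Matrix.SpecialLinearGroup (Fin 2) ℤ) (v : PrimitiveVector) :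
    primitiveAction (M * N) v = primitiveAction M (primitiveAction N v) := by
  apply Subtype.ext
  ext <;> simp [primitiveAction, Matrix.mul_apply, Fin.sum_univ_two] <;> ring

theorem primitiveAction_one (v : PrimitiveVector) : primitiveAction 1 v = v := by
  apply Subtype.ext
  ext <;> simp [primitiveAction]

/-- The permutation of the primitive vectors induced by an element of `SL(2,ℤ)`. -/
def primitivePerm (M : Matrix.SpecialLinearGroup (Fin 2) ℤ) : Equiv.Perm PrimitiveVector where
  toFun := primitiveAction M
  invFun := primitiveAction M⁻¹
  left_inv v := by rw [← primitiveAction_mul, inv_mul_cancel, primitiveAction_one]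
  right_inv v := by rw [← primitiveAction_mul, mul_inv_cancel, primitiveAction_one]

theorem planeAction_rescaledPoint (M : Matrix.SpecialLinearGroup (Fin 2) ℤ) (L : ℝ)
    (v : PrimitiveVector) :
    planeAction M (rescaledPoint L v) = rescaledPoint L (primitivePerm M v) := by
  ext <;> simp [planeAction, rescaledPoint, primitivePerm, primitiveAction] <;> ring

/-- Sums over rescaled primitive vectors are unchanged by the action of `SL(2,ℤ)`. -/
theorem tsum_rescaledPoint_planeAction (M : Matrix.SpecialLinearGroup (Fin 2) ℤ) (L : ℝ)
    (f : ℝ × ℝ → ℝ) :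
    ∑' v, f (planeAction M (rescaledPoint L v)) = ∑' v, f (rescaledPoint L v) := by
  simp_rw [planeAction_rescaledPoint]
  exact (primitivePerm M).tsum_eq fun v => f (rescaledPoint L v)

/-- **Limit points of the primitive counting measures are `SL(2,ℤ)`-invariant.**
If `μ'` is a weak-⋆ limit point along a sequence `L_k → ∞` of the rescaled primitive
counting measures `ν_L^prim := L⁻² Σ_{v primitive} δ_{v/L}` on `ℝ²`, then `μ'` is invariant
under the linear action of `SL(2,ℤ)` on `ℝ²`. -/
theorem limit_point_of_primitive_counting_measures_is_SL2Z_invariant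
    (L : ℕ → ℝ) (hLpos : ∀ k, 0 < L k) (hLtop : Tendsto L atTop atTop)
    (μ' : Measure (ℝ × ℝ)) [IsLocallyFiniteMeasure μ']
    (hconv : ∀ f : ℝ × ℝ → ℝ, Continuous f → HasCompactSupport f →
      Tendsto (fun k : ℕ =>
          (1 / (L k) ^ 2) * ∑' v : {v : ℤ × ℤ // Int.gcd v.1 v.2 = 1},
            f (((v : ℤ × ℤ).1 : ℝ) / L k, ((v : ℤ × ℤ).2 : ℝ) / L k))
        atTop (nhds (∫ x, f x ∂μ'))) :
    ∀ M : Matrix.SpecialLinearGroup (Fin 2) ℤ, ∀ A : Set (ℝ × ℝ), MeasurableSet A →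
      μ' ((fun v : ℝ × ℝ =>
          (((M : Matrix (Fin 2) (Fin 2) ℤ) 0 0 : ℝ) * v.1
              + ((M : Matrix (Fin 2) (Fin 2) ℤ) 0 1 : ℝ) * v.2,
            ((M : Matrix (Fin 2) (Fin 2) ℤ) 1 0 : ℝ) * v.1
              + ((M : Matrix (Fin 2) (Fin 2) ℤ) 1 1 : ℝ) * v.2)) '' A) = μ' A := by
  intro M A _
  have hmap : μ'.map (planeHomeomorph M).symm = μ' := by
    have : (μ'.map (planeHomeomorph M).symm).Regular :=
      Measure.Regular.map (planeHomeomorph M).symm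
    refine Measure.ext_of_integral_eq_on_compactlySupported fun f => ?_
    rw [(planeHomeomorph M).symm.measurableEmbedding.integral_map]
    refine tendsto_nhds_unique (hconv (f ∘ (planeHomeomorph M).symm)
      (f.continuous.comp (planeHomeomorph M).symm.continuous)
      (f.hasCompactSupport.comp_homeomorph (planeHomeomorph M).symm)) ?_
    refine (hconv f f.continuous f.hasCompactSupport).congr fun k => ?_
    exact congrArg _ (tsum_rescaledPoint_planeAction M⁻¹ (L k) f).symm
  change μ' (planeHomeomorph M '' A) = μ' A
  rw [(planeHomeomorph M).image_eq_preimage_symm,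
    ← (planeHomeomorph M).symm.measurableEmbedding.map_apply, hmap]
end

section
/- The Lebesgue measure on ℝ² is ergodic for the linear action of SL(2,ℤ): if A ⊆ ℝ² is a Borel (or Lebesgue-measurable) set such that {M·v : v ∈ A} = A for every M ∈ SL(2,ℤ), then either A has Lebesgue measure zero or its complement ℝ² \ A has Lebesgue measure zero. -/
open MeasureTheory
open Filter Set
open scoped ENNReal Topology

/-- The rescaled measure of the points `x'` with `|x' - x| ≤ c / n²` such that `A` separates
`(x', y)` from `(x, y)`. -/
noncomputable def sliceDiscrepancy (A : Set (ℝ × ℝ)) (c : ℝ) (n : ℕ) (x y : ℝ) : ℝ≥0∞ :=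
  (n : ℝ≥0∞) ^ 2 *
    volume {x' : ℝ | |x' - x| ≤ c / (n : ℝ) ^ 2 ∧ ¬((x', y) ∈ A ↔ (x, y) ∈ A)}

/-- The points of the square `[0, R]²` where `A`, read through the linear map
`(t, y) ↦ (ρ y - t / ρ.den², y)`, differs from its trace on the line of slope `u`. -/
def traceDefect (A : Set (ℝ × ℝ)) (R : ℝ) (u : ℝ) (ρ : ℚ) : Set (ℝ × ℝ) :=
  {z | z ∈ Icc 0 R ×ˢ Icc 0 R ∧
    ¬((ρ * z.2 - z.1 / (ρ.den : ℝ) ^ 2, z.2) ∈ A ↔ (u * z.2, z.2) ∈ A)}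

lemma measurable_sliceDiscrepancy {A : Set (ℝ × ℝ)} (hA : MeasurableSet A) (c : ℝ) (n : ℕ) :
    Measurable fun z : ℝ × ℝ => sliceDiscrepancy A c n z.1 z.2 := by
  unfold sliceDiscrepancy
  refine Measurable.const_mul ?_ _
  have h1 : MeasurableSet {p : (ℝ × ℝ) × ℝ | |p.2 - p.1.1| ≤ c / (n : ℝ) ^ 2} :=
    measurableSet_le (by fun_prop) (by fun_prop)
  have h2 : MeasurableSet {p : (ℝ × ℝ) × ℝ | (p.2, p.1.2) ∈ A} :=
    (show Measurable fun p : (ℝ × ℝ) × ℝ => (p.2, p.1.2) by fun_prop) hA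
  have h3 : MeasurableSet {p : (ℝ × ℝ) × ℝ | p.1 ∈ A} := measurable_fst hA
  exact measurable_measure_prodMk_left (ν := (volume : Measure ℝ))
    (h1.inter (Measurable.setOf ((h2.mem.iff h3.mem).not)))

lemma measurableSet_traceDefect {A : Set (ℝ × ℝ)} (hA : MeasurableSet A) (R u : ℝ) (ρ : ℚ) :
    MeasurableSet (traceDefect A R u ρ) := by
  have h1 : MeasurableSet {z : ℝ × ℝ | (ρ * z.2 - z.1 / (ρ.den : ℝ) ^ 2, z.2) ∈ A} :=
    (show Measurable fun z : ℝ × ℝ => (ρ * z.2 - z.1 / (ρ.den : ℝ) ^ 2, z.2) by fun_prop) hA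
  have h2 : MeasurableSet {z : ℝ × ℝ | (u * z.2, z.2) ∈ A} :=
    (show Measurable fun z : ℝ × ℝ => (u * z.2, z.2) by fun_prop) hA
  exact (measurableSet_Icc.prod measurableSet_Icc).inter
    (Measurable.setOf ((h1.mem.iff h2.mem).not))

/-- Lebesgue's density theorem on horizontal lines. -/
lemma ae_tendsto_sliceDiscrepancy_right {A : Set (ℝ × ℝ)} (hA : MeasurableSet A) {c : ℝ}
    (hc : 0 < c) (y : ℝ) :
    ∀ᵐ x : ℝ, Tendsto (fun n => sliceDiscrepancy A c n x y) atTop (𝓝 0) := by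
  have hS : MeasurableSet {x : ℝ | (x, y) ∈ A} :=
    (show Measurable fun x : ℝ => (x, y) by fun_prop) hA
  have hr : Tendsto (fun n : ℕ => c / (n : ℝ) ^ 2) atTop (𝓝[>] 0) := by
    refine tendsto_nhdsWithin_iff.2 ⟨?_, ?_⟩
    · exact tendsto_const_nhds.div_atTop
        ((tendsto_pow_atTop two_ne_zero).comp tendsto_natCast_atTop_atTop)
    · filter_upwards [eventually_gt_atTop 0] with n hn
      have : (0 : ℝ) < n := by exact_mod_cast hn
      exact div_pos hc (by positivity)
  have key : ∀ (T : Set ℝ) (x : ℝ),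
      Tendsto (fun r => volume (T ∩ Metric.closedBall x r) / volume (Metric.closedBall x r))
        (𝓝[>] 0) (𝓝 0) →
      {x' : ℝ | ¬((x', y) ∈ A ↔ (x, y) ∈ A)} = T →
      Tendsto (fun n => sliceDiscrepancy A c n x y) atTop (𝓝 0) := by
    intro T x hT hTA
    have h := ENNReal.Tendsto.const_mul (a := ENNReal.ofReal (2 * c)) (hT.comp hr)
      (Or.inr ENNReal.ofReal_ne_top)
    rw [mul_zero] at h
    refine h.congr' ?_
    filter_upwards [eventually_gt_atTop 0] with n hn
    have hn' : (0 : ℝ) < n := by exact_mod_cast hn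
    have hset : {x' : ℝ | |x' - x| ≤ c / (n : ℝ) ^ 2 ∧ ¬((x', y) ∈ A ↔ (x, y) ∈ A)}
        = T ∩ Metric.closedBall x (c / (n : ℝ) ^ 2) := by
      rw [← hTA]
      ext x'
      simp only [mem_ofPred_eq, mem_inter_iff, Metric.mem_closedBall, Real.dist_eq]
      tauto
    have hq : ENNReal.ofReal (2 * c) / ENNReal.ofReal (2 * (c / (n : ℝ) ^ 2))
        = (n : ℝ≥0∞) ^ 2 := by
      rw [← ENNReal.ofReal_div_of_pos (by positivity)]
      have : 2 * c / (2 * (c / (n : ℝ) ^ 2)) = (n : ℝ) ^ 2 := by field_simp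
      rw [this, ENNReal.ofReal_pow hn'.le, ENNReal.ofReal_natCast]
    simp only [Function.comp, sliceDiscrepancy, hset, Real.volume_closedBall]
    rw [← hq, ENNReal.div_eq_inv_mul, ENNReal.div_eq_inv_mul]
    ring
  filter_upwards [Besicovitch.ae_tendsto_measure_inter_div_of_measurableSet volume hS,
    Besicovitch.ae_tendsto_measure_inter_div_of_measurableSet volume hS.compl] with x h1 h2
  by_cases hx : (x, y) ∈ A
  · refine key _ x (by simpa [hx] using h2) ?_
    ext x'
    simp [hx]
  · refine key _ x (by simpa [hx] using h1) ?_
    ext x'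
    simp [hx]

/-- A measurable set is conull in the plane iff almost every line through the origin meets it in
a conull set. -/
lemma ae_ae_mem_line_iff {G : Set (ℝ × ℝ)} (hG : MeasurableSet G) :
    (∀ᵐ u : ℝ, ∀ᵐ y : ℝ, (u * y, y) ∈ G) ↔ ∀ᵐ z : ℝ × ℝ, z ∈ G := by
  have h0 : ∀ᵐ y : ℝ, y ≠ 0 := (countable_singleton (0 : ℝ)).ae_notMem volume
  rw [Measure.volume_eq_prod, Measure.ae_prod_mem_iff_ae_ae_mem hG,
    Measure.ae_ae_comm (p := fun u y : ℝ => (u * y, y) ∈ G)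
      ((show Measurable fun z : ℝ × ℝ => (z.1 * z.2, z.2) by fun_prop) hG),
    Measure.ae_ae_comm (p := fun x y : ℝ => (x, y) ∈ G) hG]
  refine eventually_congr (h0.mono fun y hy => ?_)
  rw [ae_iff, ae_iff]
  have h := Real.volume_preimage_mul_right hy {x : ℝ | (x, y) ∉ G}
  rw [show {u : ℝ | (u * y, y) ∉ G} = (fun x => x * y) ⁻¹' {x : ℝ | (x, y) ∉ G} from rfl, h]
  simp [hy]

lemma ae_ae_tendsto_sliceDiscrepancy {A : Set (ℝ × ℝ)} (hA : MeasurableSet A) {c : ℝ}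
    (hc : 0 < c) :
    ∀ᵐ u : ℝ, ∀ᵐ y : ℝ, Tendsto (fun n => sliceDiscrepancy A c n (u * y) y) atTop (𝓝 0) := by
  have hG : MeasurableSet
      {z : ℝ × ℝ | Tendsto (fun n => sliceDiscrepancy A c n z.1 z.2) atTop (𝓝 0)} :=
    measurableSet_tendsto _ fun n => measurable_sliceDiscrepancy hA c n
  refine (ae_ae_mem_line_iff hG).2 ?_
  rw [Measure.volume_eq_prod, Measure.ae_prod_mem_iff_ae_ae_mem hG]
  exact (Measure.ae_ae_comm (p := fun x y : ℝ => (x, y) ∈ _) hG).2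
    (ae_of_all _ fun y => ae_tendsto_sliceDiscrepancy_right hA hc y)

lemma volume_slice_traceDefect_le (A : Set (ℝ × ℝ)) {R u : ℝ} {ρ : ℚ}
    (hρ : |u - ρ| ≤ 1 / (ρ.den : ℝ) ^ 2) (y : ℝ) :
    volume ((fun t => (t, y)) ⁻¹' traceDefect A R u ρ) ≤
      sliceDiscrepancy A (2 * R) ρ.den (u * y) y := by
  have hq : (0 : ℝ) < (ρ.den : ℝ) ^ 2 := by have := ρ.pos; positivity
  set D := {x' : ℝ | |x' - u * y| ≤ 2 * R / (ρ.den : ℝ) ^ 2 ∧ ¬((x', y) ∈ A ↔ (u * y, y) ∈ A)}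
    with hD
  have hsub : (fun t => (t, y)) ⁻¹' traceDefect A R u ρ ⊆
      (fun t => (-1 / (ρ.den : ℝ) ^ 2) * t) ⁻¹' ((fun x => ρ * y + x) ⁻¹' D) := by
    rintro t ⟨⟨⟨ht0, htR⟩, hy0, hyR⟩, ht⟩
    simp only at ht0 htR hy0 hyR ht
    have e : ρ * y + -1 / (ρ.den : ℝ) ^ 2 * t = ρ * y - t / (ρ.den : ℝ) ^ 2 := by ring
    simp only [hD, mem_preimage, mem_ofPred_eq, e]
    refine ⟨?_, ht⟩
    have h1 : |(u - ρ) * y| ≤ R / (ρ.den : ℝ) ^ 2 := by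
      rw [abs_mul, abs_of_nonneg hy0]
      calc _ ≤ 1 / (ρ.den : ℝ) ^ 2 * R := by gcongr
        _ = _ := by ring
    have h2 : t / (ρ.den : ℝ) ^ 2 ≤ R / (ρ.den : ℝ) ^ 2 := by gcongr
    have h3 : 0 ≤ t / (ρ.den : ℝ) ^ 2 := by positivity
    have h4 : 2 * R / (ρ.den : ℝ) ^ 2 = R / (ρ.den : ℝ) ^ 2 + R / (ρ.den : ℝ) ^ 2 := by ring
    rw [abs_le] at h1 ⊢
    constructor <;> nlinarith
  refine (measure_mono hsub).trans ?_
  rw [Real.volume_preimage_mul_left (by simp), measure_preimage_add]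
  have : |(-1 / (ρ.den : ℝ) ^ 2)⁻¹| = (ρ.den : ℝ) ^ 2 := by
    rw [inv_div, div_neg, div_one, abs_neg, abs_of_pos hq]
  rw [this, ENNReal.ofReal_pow (by positivity), ENNReal.ofReal_natCast]
  rfl

lemma tendsto_volume_traceDefect {A : Set (ℝ × ℝ)} (hA : MeasurableSet A) {R u : ℝ} {ρ : ℕ → ℚ}
    (hu : ∀ᵐ y : ℝ, Tendsto (fun n => sliceDiscrepancy A (2 * R) n (u * y) y) atTop (𝓝 0))
    (hden : Tendsto (fun k => (ρ k).den) atTop atTop)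
    (hρ : ∀ k, |u - ρ k| ≤ 1 / ((ρ k).den : ℝ) ^ 2) :
    Tendsto (fun k => volume (traceDefect A R u (ρ k))) atTop (𝓝 0) := by
  have h := tendsto_lintegral_of_dominated_convergence (μ := (volume : Measure ℝ))
    (F := fun k y => volume ((fun t => (t, y)) ⁻¹' traceDefect A R u (ρ k))) (f := fun _ => 0)
    ((Icc 0 R).indicator fun _ => volume (Icc 0 R))
    (fun k => measurable_measure_prodMk_right (measurableSet_traceDefect hA R u (ρ k)))
    (fun k => ae_of_all _ fun y => ?_) ?_ ?_
  · simpa only [lintegral_zero, Measure.volume_eq_prod,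
      Measure.prod_apply_symm (measurableSet_traceDefect hA R u _)] using h
  · by_cases hy : y ∈ Icc 0 R
    · simp only [indicator_of_mem hy]
      exact measure_mono fun t ht => ht.1.1
    · have : (fun t => (t, y)) ⁻¹' traceDefect A R u (ρ k) = ∅ :=
        eq_empty_of_forall_notMem fun t ht => hy ht.1.2
      simp [this]
  · rw [lintegral_indicator measurableSet_Icc, setLIntegral_const]
    simp [ENNReal.mul_eq_top]
  · filter_upwards [hu] with y hy
    exact tendsto_of_tendsto_of_tendsto_of_le_of_le tendsto_const_nhds (hy.comp hden)
      (fun _ => zero_le) fun k => volume_slice_traceDefect_le A (hρ k) y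

/-- An irrational number has rational approximations `ρ` with `|u - ρ| ≤ 1 / ρ.den²` and
arbitrarily large denominators. -/
lemma Irrational.exists_seq_rat_approx {u : ℝ} (hu : Irrational u) :
    ∃ ρ : ℕ → ℚ, Tendsto (fun k => (ρ k).den) atTop atTop ∧
      ∀ k, |u - ρ k| ≤ 1 / ((ρ k).den : ℝ) ^ 2 := by
  choose ρ hρ hle using fun n : ℕ => Real.exists_rat_abs_sub_le_and_den_le u n.succ_pos
  refine ⟨ρ, tendsto_atTop.2 fun N => ?_, fun k => (hρ k).trans ?_⟩
  · have h1 : Tendsto (fun k : ℕ => 1 / ((k : ℝ) + 1)) atTop (𝓝 0) :=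
      tendsto_one_div_add_atTop_nhds_zero_nat
    obtain ⟨ε, hε, hε0⟩ := ((hu.eventually_forall_le_dist_cast_rat_of_den_le N).filter_mono
      nhdsWithin_le_nhds |>.and (self_mem_nhdsWithin (s := Ioi (0 : ℝ)))).exists
    filter_upwards [h1.eventually (gt_mem_nhds hε0)] with k hk
    by_contra! hlt
    have h2 := hε (ρ k) hlt.le
    rw [Real.dist_eq] at h2
    have h3 : 1 / (((k.succ : ℕ) + 1 : ℝ) * (ρ k).den) ≤ 1 / ((k : ℝ) + 1) := by
      have : (1 : ℝ) ≤ (ρ k).den := by exact_mod_cast (ρ k).pos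
      gcongr
      push_cast
      nlinarith [(Nat.cast_nonneg k : (0 : ℝ) ≤ k)]
    linarith [hρ k]
  · have h0 : (0 : ℝ) < (ρ k).den := by exact_mod_cast (ρ k).pos
    have h1 : ((ρ k).den : ℝ) ≤ k.succ := by exact_mod_cast hle k
    rw [sq]
    gcongr
    linarith

/-- Invariance of a set in the plane under the linear action of `SL(2, ℤ)`, in coordinates. -/
def IsSL2ZInvariant (A : Set (ℝ × ℝ)) : Prop :=
  ∀ a b c d : ℤ, a * d - b * c = 1 →
    ∀ x y : ℝ, ((a * x + b * y, c * x + d * y) ∈ A ↔ (x, y) ∈ A)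

lemma IsSL2ZInvariant.compl {A : Set (ℝ × ℝ)} (h : IsSL2ZInvariant A) : IsSL2ZInvariant Aᶜ :=
  fun a b c d hdet x y => not_congr (h a b c d hdet x y)

/-- The parabolic matrix fixing `ρ` acts as the shear `(t, y) ↦ (t, t + y)` in the coordinates
`(t, y) ↦ (ρ y - t / ρ.den², y)`. -/
lemma IsSL2ZInvariant.parabolic_mem_iff {A : Set (ℝ × ℝ)} (h : IsSL2ZInvariant A) (ρ : ℚ)
    (t y : ℝ) :
    (ρ * (t + y) - t / (ρ.den : ℝ) ^ 2, t + y) ∈ A ↔ (ρ * y - t / (ρ.den : ℝ) ^ 2, y) ∈ A := by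
  have hq : (ρ.den : ℝ) ≠ 0 := by exact_mod_cast ρ.den_nz
  have hρ : (ρ : ℝ) = ρ.num / ρ.den := Rat.cast_def ρ
  rw [← h (1 - ρ.num * ρ.den) (ρ.num ^ 2) (-(ρ.den : ℤ) ^ 2) (1 + ρ.num * ρ.den) (by ring)
    (ρ * y - t / (ρ.den : ℝ) ^ 2) y]
  apply iff_of_eq
  congr 2
  · push_cast
    rw [hρ]
    field_simp
    ring
  · push_cast
    rw [hρ]
    field_simp
    ring

lemma ae_line_shift_iff {A : Set (ℝ × ℝ)} (hA : MeasurableSet A) (hinv : IsSL2ZInvariant A)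
    {R u : ℝ} (hirr : Irrational u)
    (hu : ∀ᵐ y : ℝ, Tendsto (fun n => sliceDiscrepancy A (2 * (2 * R)) n (u * y) y) atTop (𝓝 0)) :
    ∀ᵐ z : ℝ × ℝ, z ∈ Icc 0 R ×ˢ Icc 0 R →
      ((u * z.2, z.2) ∈ A ↔ (u * (z.1 + z.2), z.1 + z.2) ∈ A) := by
  obtain ⟨ρ, hden, hρ⟩ := hirr.exists_seq_rat_approx
  have hlim := tendsto_volume_traceDefect hA hu hden hρ
  have hshear : MeasurePreserving (fun z : ℝ × ℝ => (z.1, z.1 + z.2)) :=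
    measurePreserving_prod_add volume volume
  rw [ae_iff]
  have hlim2 := hlim.add hlim
  rw [add_zero] at hlim2
  refine le_antisymm (ge_of_tendsto' hlim2 fun k => ?_) zero_le
  calc _ ≤ volume (traceDefect A (2 * R) u (ρ k) ∪
        (fun z : ℝ × ℝ => (z.1, z.1 + z.2)) ⁻¹' traceDefect A (2 * R) u (ρ k)) := by
        refine measure_mono fun z hz => ?_
        obtain ⟨t, y⟩ := z
        simp only [mem_ofPred_eq, Classical.not_imp, mem_prod, mem_Icc] at hz
        obtain ⟨⟨⟨ht0, htR⟩, hy0, hyR⟩, hne⟩ := hz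
        by_contra hcon
        simp only [mem_union, mem_preimage, traceDefect, mem_ofPred_eq, mem_prod, mem_Icc,
          hinv.parabolic_mem_iff, not_or, not_and, not_not] at hcon
        have h1 := hcon.1 ⟨⟨ht0, by linarith⟩, hy0, by linarith⟩
        have h2 := hcon.2 ⟨⟨ht0, by linarith⟩, by linarith, by linarith⟩
        exact hne (h1.symm.trans h2)
    _ ≤ _ := by
        refine (measure_union_le _ _).trans (le_of_eq ?_)
        rw [hshear.measure_preimage (measurableSet_traceDefect hA _ _ _).nullMeasurableSet]

/-- A symmetric set that is almost everywhere invariant under positive translations of the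
positive half-line is null or conull. -/
lemma ae_mem_or_ae_notMem_of_shift {P : Set ℝ}
    (h : ∀ᵐ z : ℝ × ℝ, 0 ≤ z.1 → 0 ≤ z.2 → (z.2 ∈ P ↔ z.1 + z.2 ∈ P))
    (hneg : ∀ y, -y ∈ P ↔ y ∈ P) :
    (∀ᵐ y : ℝ, y ∈ P) ∨ ∀ᵐ y : ℝ, y ∉ P := by
  have hswap : ∀ᵐ z : ℝ × ℝ, 0 ≤ z.2 → 0 ≤ z.1 → (z.1 ∈ P ↔ z.2 + z.1 ∈ P) :=
    (Measure.measurePreserving_swap (μ := (volume : Measure ℝ))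
      (ν := (volume : Measure ℝ))).quasiMeasurePreserving.ae h
  have hgood : ∀ᵐ y : ℝ, 0 ≤ y → ∀ᵐ z : ℝ, y ≤ z → (y ∈ P ↔ z ∈ P) := by
    filter_upwards [Measure.ae_ae_of_ae_prod hswap] with y hy hy0
    filter_upwards [(measurePreserving_sub_right (volume : Measure ℝ)
      y).quasiMeasurePreserving.ae hy] with z hz hyz
    simpa using hz (by linarith) hy0
  have key : ∀ Q : ℝ → Prop, (∀ y, Q (-y) ↔ Q y) → (∀ᵐ y : ℝ, 0 ≤ y → Q y) → ∀ᵐ y : ℝ, Q y := by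
    intro Q hQ hpos
    filter_upwards [hpos, (Measure.measurePreserving_neg
      (volume : Measure ℝ)).quasiMeasurePreserving.ae hpos] with y h1 h2
    rcases le_total 0 y with hy | hy
    · exact h1 hy
    · exact (hQ y).1 (h2 (by linarith))
  by_cases hex : ∃ y, (0 ≤ y ∧ ∀ᵐ z : ℝ, y ≤ z → (y ∈ P ↔ z ∈ P)) ∧ y ∈ P
  · obtain ⟨y₀, ⟨-, hy₀⟩, hP⟩ := hex
    left
    refine key _ hneg (hgood.mono fun y hy hy0 => ?_)
    have hfreq : ∃ᵐ z : ℝ, max y y₀ ≤ z := by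
      rw [frequently_ae_iff, show {a : ℝ | max y y₀ ≤ a} = Ici (max y y₀) from rfl,
        Real.volume_Ici]
      exact ENNReal.top_ne_zero
    obtain ⟨z, hz, h1, h2⟩ := (hfreq.and_eventually ((hy hy0).and hy₀)).exists
    exact (h1 ((le_max_left _ _).trans hz)).2 ((h2 ((le_max_right _ _).trans hz)).1 hP)
  · right
    refine key _ (fun y => not_congr (hneg y)) (hgood.mono fun y hy hy0 hP => hex ?_)
    exact ⟨y, ⟨hy0, hy hy0⟩, hP⟩

lemma ae_irrational : ∀ᵐ u : ℝ, Irrational u :=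
  (countable_range ((↑) : ℚ → ℝ)).ae_notMem volume

lemma ae_line_mem_or_notMem {A : Set (ℝ × ℝ)} (hA : MeasurableSet A)
    (hinv : IsSL2ZInvariant A) :
    ∀ᵐ u : ℝ, (∀ᵐ y : ℝ, (u * y, y) ∈ A) ∨ ∀ᵐ y : ℝ, (u * y, y) ∉ A := by
  have hR : ∀ᵐ u : ℝ, ∀ N : ℕ, ∀ᵐ y : ℝ,
      Tendsto (fun n => sliceDiscrepancy A (2 * (2 * (N + 1 : ℝ))) n (u * y) y) atTop (𝓝 0) :=
    ae_all_iff.2 fun N => ae_ae_tendsto_sliceDiscrepancy hA (by positivity)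
  filter_upwards [hR, ae_irrational] with u hu hirr
  refine ae_mem_or_ae_notMem_of_shift (P := {y | (u * y, y) ∈ A}) ?_ fun y => ?_
  · filter_upwards [ae_all_iff.2 fun N => ae_line_shift_iff hA hinv hirr (hu N)] with z hz h1 h2
    obtain ⟨N, hN⟩ := exists_nat_ge (max z.1 z.2)
    have := max_le_iff.1 hN
    exact hz N ⟨⟨h1, by linarith⟩, h2, by linarith⟩
  · simpa using hinv (-1) 0 0 (-1) (by norm_num) (u * y) y

lemma ae_div_mem_iff {A : Set (ℝ × ℝ)} (hA : MeasurableSet A) (hinv : IsSL2ZInvariant A)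
    {r : ℝ} (hr : r ≠ 0) :
    ∀ᵐ z : ℝ × ℝ, ((z.1 / r, z.2 / r) ∈ A ↔ z ∈ A) := by
  have h1 : MeasurableSet {z : ℝ × ℝ | (z.1 / r, z.2 / r) ∈ A} :=
    (show Measurable fun z : ℝ × ℝ => (z.1 / r, z.2 / r) by fun_prop) hA
  have hG : MeasurableSet {z : ℝ × ℝ | (z.1 / r, z.2 / r) ∈ A ↔ z ∈ A} :=
    Measurable.setOf (h1.mem.iff hA.mem)
  have hdiv : ∀ p : ℝ → Prop, (∀ᵐ y, p y) → ∀ᵐ y, p (y / r) := by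
    intro p hp
    rw [ae_iff] at hp ⊢
    have h := Real.volume_preimage_mul_right (inv_ne_zero hr) {y | ¬ p y}
    rw [hp, mul_zero] at h
    simp only [div_eq_mul_inv]
    exact h
  refine (ae_ae_mem_line_iff hG).1 ?_
  filter_upwards [ae_line_mem_or_notMem hA hinv] with u hu
  rcases hu with hu | hu
  · filter_upwards [hu, hdiv _ hu] with y h2 h3
    exact iff_of_true (by simpa only [mul_div_assoc] using h3) h2
  · filter_upwards [hu, hdiv _ hu] with y h2 h3
    exact iff_of_false (by simpa only [mul_div_assoc] using h3) h2

lemma Rat.exists_bezout (ρ : ℚ) :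
    ∃ p q : ℤ, ρ.num * q - p * ρ.den = 1 ∧ 0 ≤ q ∧ q ≤ ρ.den := by
  have hcop : IsCoprime ρ.num ρ.den := ρ.isCoprime_num_den
  obtain ⟨a, b, hab⟩ := hcop
  have hpos : (0 : ℤ) < ρ.den := by exact_mod_cast ρ.pos
  refine ⟨-b - ρ.num * (a / ρ.den), a % ρ.den, ?_, Int.emod_nonneg _ hpos.ne',
    (Int.emod_lt_of_pos _ hpos).le⟩
  linear_combination hab + ρ.num * Int.emod_add_mul_ediv a ρ.den

lemma measurePreserving_shear (r : ℝ) :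
    MeasurePreserving (fun z : ℝ × ℝ => (z.2, z.1 + r * z.2)) := by
  have h : MeasurePreserving (fun z : ℝ × ℝ => (z.1, z.2 + r * z.1)) :=
    (MeasurePreserving.id volume).skew_product (g := fun t s : ℝ => s + r * t) (by fun_prop)
      (ae_of_all _ fun t => map_add_right_eq_self volume (r * t))
  exact h.comp Measure.measurePreserving_swap

lemma ae_unitSquare_mem_of_ae_line_mem {A : Set (ℝ × ℝ)} (hA : MeasurableSet A)
    (hinv : IsSL2ZInvariant A) :
    ∀ᵐ u : ℝ, (∀ᵐ y : ℝ, (u * y, y) ∈ A) →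
      ∀ᵐ z : ℝ × ℝ, z ∈ Icc (0 : ℝ) 1 ×ˢ Icc (0 : ℝ) 1 → z ∈ A := by
  filter_upwards [ae_ae_tendsto_sliceDiscrepancy hA (c := 2 * 2) (by norm_num), ae_irrational]
    with u hu hirr hline
  obtain ⟨ρ, hden, hρ⟩ := hirr.exists_seq_rat_approx
  have hlim := tendsto_volume_traceDefect hA hu hden hρ
  have hline' : ∀ᵐ z : ℝ × ℝ, (u * z.2, z.2) ∈ A :=
    (Measure.quasiMeasurePreserving_snd (μ := (volume : Measure ℝ))
      (ν := (volume : Measure ℝ))).ae hline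
  rw [ae_iff]
  refine le_antisymm (ge_of_tendsto' hlim fun k => ?_) zero_le
  obtain ⟨p, q, hdet, hq0, hqle⟩ := (ρ k).exists_bezout
  set d : ℝ := ((ρ k).den : ℝ) with hd
  have hd0 : 0 < d := by simpa [hd] using (ρ k).pos
  have hΦ := measurePreserving_shear (q / d)
  rw [← hΦ.measure_preimage (measurableSet_traceDefect hA 2 u (ρ k)).nullMeasurableSet]
  refine measure_mono_ae ?_
  filter_upwards [ae_div_mem_iff hA hinv hd0.ne', hΦ.quasiMeasurePreserving.ae hline']
    with z hz hzu hbad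
  obtain ⟨s, t⟩ := z
  simp only at hz hzu
  obtain ⟨⟨⟨hs0, hs1⟩, ht0, ht1⟩, hnot⟩ := Classical.not_imp.1 hbad
  simp only at hs0 hs1 ht0 ht1
  have hr0 : 0 ≤ q / d := div_nonneg (by exact_mod_cast hq0) hd0.le
  have hr1 : q / d ≤ 1 := (div_le_one hd0).2 (by rw [hd]; exact_mod_cast hqle)
  have hdetR : ((ρ k).num : ℝ) * q - p * d = 1 := by rw [hd]; exact_mod_cast hdet
  have hmem : (ρ k * (s + q / d * t) - t / d ^ 2, s + q / d * t) ∉ A := by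
    rw [← hz, ← hinv _ _ _ _ hdet] at hnot
    convert hnot using 3
    · rw [Rat.cast_def, ← hd]
      field_simp
      linear_combination t * hdetR
    · rw [Int.cast_natCast, ← hd]
      field_simp
  refine ⟨⟨⟨ht0, ?_⟩, ?_, ?_⟩, fun hiff => hmem (hiff.2 hzu)⟩
  · exact ht1.trans one_le_two
  · positivity
  · change s + q / d * t ≤ 2
    nlinarith

lemma IsSL2ZInvariant.null_or_conull {A : Set (ℝ × ℝ)} (hA : MeasurableSet A)
    (hinv : IsSL2ZInvariant A) : (∀ᵐ z : ℝ × ℝ, z ∉ A) ∨ ∀ᵐ z : ℝ × ℝ, z ∈ A := by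
  have hdich := ae_line_mem_or_notMem hA hinv
  have hin := ae_unitSquare_mem_of_ae_line_mem hA hinv
  have hout := ae_unitSquare_mem_of_ae_line_mem hA.compl hinv.compl
  by_cases hsq : ∀ᵐ z : ℝ × ℝ, z ∈ Icc (0 : ℝ) 1 ×ˢ Icc (0 : ℝ) 1 → z ∈ A
  · right
    refine (ae_ae_mem_line_iff hA).1 ?_
    filter_upwards [hdich, hout] with u hu hu'
    refine hu.resolve_right fun hno => ?_
    have hfreq : ∃ᵐ z : ℝ × ℝ, z ∈ Icc (0 : ℝ) 1 ×ˢ Icc (0 : ℝ) 1 := by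
      rw [frequently_ae_mem_iff, Measure.volume_eq_prod, Measure.prod_prod]
      simp
    obtain ⟨z, hz, h1, h2⟩ := (hfreq.and_eventually (hsq.and (hu' hno))).exists
    exact h2 hz (h1 hz)
  · left
    refine (ae_ae_mem_line_iff hA.compl).1 ?_
    filter_upwards [hdich, hin] with u hu hu'
    exact hu.resolve_left fun hyes => hsq (hu' hyes)

/-- **Ergodicity of the `SL(2,ℤ)` action on `ℝ²` with respect to Lebesgue measure.**
If a measurable set `A ⊆ ℝ²` is invariant under the linear action of every
`M ∈ SL(2,ℤ)`, then `A` or its complement has Lebesgue measure zero. -/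
theorem SL2Z_action_on_plane_ergodic
    (A : Set (ℝ × ℝ)) (hA : MeasurableSet A)
    (hinv : ∀ M : Matrix.SpecialLinearGroup (Fin 2) ℤ,
      (fun v : ℝ × ℝ =>
          (((M : Matrix (Fin 2) (Fin 2) ℤ) 0 0 : ℝ) * v.1
              + ((M : Matrix (Fin 2) (Fin 2) ℤ) 0 1 : ℝ) * v.2,
            ((M : Matrix (Fin 2) (Fin 2) ℤ) 1 0 : ℝ) * v.1
              + ((M : Matrix (Fin 2) (Fin 2) ℤ) 1 1 : ℝ) * v.2)) '' A = A) :
    volume A = 0 ∨ volume Aᶜ = 0 := by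
  have hinv' : IsSL2ZInvariant A := by
    intro a b c d hdet x y
    have hM := hinv ⟨!![a, b; c, d], by rw [Matrix.det_fin_two_of, hdet]⟩
    have hN := hinv ⟨!![d, -b; -c, a], by rw [Matrix.det_fin_two_of]; linear_combination hdet⟩
    simp only [Matrix.of_apply, Matrix.cons_val', Matrix.cons_val_zero, Matrix.cons_val_one,
      Matrix.cons_val_fin_one] at hM hN
    have hdetR : (a : ℝ) * d - b * c = 1 := by exact_mod_cast hdet
    constructor
    · intro h
      rw [← hN]
      refine ⟨_, h, Prod.ext ?_ ?_⟩
      · push_cast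
        linear_combination x * hdetR
      · push_cast
        linear_combination y * hdetR
    · intro h
      rw [← hM]
      exact ⟨_, h, rfl⟩
  refine (hinv'.null_or_conull hA).imp (fun h => ?_) fun h => ?_
  · simpa [ae_iff] using h
  · exact h
end

section
/- Let G be a countable group acting measurably on a measurable space X, let μ be a σ-finite measure on X invariant under the action of G, and let H be a subgroup of G. Let f : X → [0,∞] be a measurable function that is H-invariant, i.e. f(h·x) = f(x) for all h ∈ H and x ∈ X; then for each right coset Hg ∈ H\G the value f(g·x) does not depend on the choice of representative g of the coset. Let s ⊆ X be a fundamental domain for the action of G on (X,μ) and t ⊆ X a fundamental domain for the action of H on (X,μ). Then ∫_t f dμ = ∫_s ( Σ_{Hg ∈ H\G} f(g·x) ) dμ(x). -/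
open MeasureTheory
open scoped ENNReal

namespace MeasureTheory.IsFundamentalDomain

open scoped Pointwise

/-- Almost every orbit meets a fundamental domain of a countable group exactly once. -/
theorem ae_existsUnique_smul_mem {G X : Type*} [Group G] [Countable G] [MeasurableSpace X]
    [MulAction G X] {μ : Measure X} {t : Set X} (ht : IsFundamentalDomain G t μ) :
    ∀ᵐ x ∂μ, ∃! g : G, g • x ∈ t := by
  have hdisj : ∀ᵐ x ∂μ, ∀ g₁ g₂ : G, g₁ ≠ g₂ → ¬(x ∈ g₁ • t ∧ x ∈ g₂ • t) := by
    refine ae_all_iff.2 fun g₁ => ae_all_iff.2 fun g₂ => ?_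
    by_cases hne : g₁ = g₂
    · simp [hne]
    · filter_upwards [measure_eq_zero_iff_ae_notMem.1 (ht.aedisjoint hne)] with x hx _
      exact hx
  filter_upwards [ht.ae_covers, hdisj] with x ⟨g, hg⟩ hx
  refine ⟨g, hg, fun g' hg' => ?_⟩
  by_contra hne
  refine hx g'⁻¹ g⁻¹ (fun h => hne (inv_injective h)) ⟨?_, ?_⟩ <;>
    simpa [Set.mem_smul_set_iff_inv_smul_mem]

end MeasureTheory.IsFundamentalDomain

/-- Every element of a group is uniquely the product of an element of a subgroup `H` and the chosen
representative of a right coset of `H`. -/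
theorem Subgroup.bijective_mul_out_rightRel {G : Type*} [Group G] (H : Subgroup G) :
    Function.Bijective
      fun p : Quotient (QuotientGroup.rightRel H) × H => (p.2 : G) * p.1.out := by
  have hmk (q : Quotient (QuotientGroup.rightRel H)) (h : H) :
      (Quotient.mk _ ((h : G) * q.out) : Quotient (QuotientGroup.rightRel H)) = q := by
    conv_rhs => rw [← q.out_eq]
    refine Quotient.sound (QuotientGroup.rightRel_apply.2 ?_)
    simp
  constructor
  · rintro ⟨q, h⟩ ⟨q', h'⟩ heq
    dsimp only at heq
    obtain rfl : q = q' := by rw [← hmk q h, heq, hmk]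
    simpa using heq
  · intro g
    have hg := QuotientGroup.rightRel_apply.1
      (Quotient.mk_out (s := QuotientGroup.rightRel H) g)
    exact ⟨⟨Quotient.mk _ g, ⟨_, hg⟩⟩, by simp⟩

/-- **Local change of variables (unfolding) formula.** Let a countable group `G` act
measurably on `(X,μ)` preserving `μ`, let `H ≤ G`, and let `f : X → [0,∞]` be a measurable
`H`-invariant function. If `s` is a fundamental domain for `G` and `t` is a fundamental
domain for `H`, then `∫_t f dμ = ∫_s Σ_{Hg ∈ H\G} f(g·x) dμ(x)`, where the summand
`f(g·x)` is well defined on right cosets by the `H`-invariance of `f`. -/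
theorem unfolding_formula
    {G X : Type*} [Group G] [Countable G] [MeasurableSpace X] [MulAction G X]
    (μ : Measure X)
    (hinv : ∀ g : G, MeasurePreserving (fun x : X => g • x) μ μ)
    (H : Subgroup G)
    (f : X → ℝ≥0∞) (hf : Measurable f)
    (hfH : ∀ (h : H) (x : X), f ((h : G) • x) = f x)
    (s t : Set X)
    (hs : IsFundamentalDomain G s μ)
    (ht : IsFundamentalDomain H t μ) :
    ∫⁻ x in t, f x ∂μ =
      ∫⁻ x in s, ∑' q : Quotient (QuotientGroup.rightRel H),
        Quotient.liftOn q (fun g : G => f (g • x))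
          (fun g₁ g₂ hg => by
            have hmem : g₂ * g₁⁻¹ ∈ H := QuotientGroup.rightRel_apply.mp hg
            have : f (g₂ • x) = f (g₁ • x) := by
              have := hfH ⟨g₂ * g₁⁻¹, hmem⟩ (g₁ • x)
              simpa [mul_smul, smul_smul] using this
            exact this.symm) ∂μ := by
  have : MeasurableConstSMul G X := ⟨fun g => (hinv g).measurable⟩
  have : SMulInvariantMeasure G X μ :=
    ⟨fun g _ hA => (hinv g).measure_preimage hA.nullMeasurableSet⟩
  have hF : AEMeasurable (t.indicator f) μ := hf.aemeasurable.indicator₀ ht.nullMeasurableSet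
  rw [← lintegral_indicator₀ ht.nullMeasurableSet, hs.lintegral_eq_tsum'',
    ← lintegral_tsum (f := fun g x => t.indicator f (g • x)) fun g =>
      (hF.comp_quasiMeasurePreserving (hinv g).quasiMeasurePreserving).restrict]
  refine lintegral_congr_ae (ae_restrict_of_ae ?_)
  have hunique : ∀ᵐ x ∂μ, ∀ g : G, ∃! h : H, h • g • x ∈ t :=
    ae_all_iff.2 fun g => (hinv g).quasiMeasurePreserving.ae ht.ae_existsUnique_smul_mem
  filter_upwards [hunique] with x hx
  rw [← (Equiv.ofBijective _ H.bijective_mul_out_rightRel).tsum_eq, ENNReal.tsum_prod']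
  refine tsum_congr fun q => ?_
  obtain ⟨h, hh, huniq⟩ := hx q.out
  rw [tsum_eq_single h]
  · conv_rhs => rw [← q.out_eq]
    simp only [Equiv.ofBijective_apply, mul_smul, Quotient.lift_mk]
    rw [Set.indicator_of_mem (by exact hh), hfH]
  · intro h' hne
    simp only [Equiv.ofBijective_apply, mul_smul]
    exact Set.indicator_of_notMem (fun hmem => hne (huniq h' hmem)) _
end
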